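/- arXiv:1903.11635 — 2 statements merged into one kernel-verified Lean document; each statement's English description precedes it below -/
import Mathlib

section
/- There exist constants C, c > 0 and N ∈ ℕ such that for all n ≥ N the following holds: if w₀, w₁, …, w_n are independent random variables, each uniformly distributed on the interval [−1,1], and f : {−1,1}^n → {−1,1} is the random linear threshold function f(x) = sign(w₀ + Σ_{i=1}^n w_i x_i), then with probability at least 1 − e^{−c n} over the choice of the weights, the Fourier-Entropy-Influence inequality H(f) ≤ C·Inf(f) holds. -/
open Finset Real MeasureTheory ProbabilityTheory
open scoped Classical

/-- sign: maps z to 1 if z > 0 and to −1 if z ≤ 0. -/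
noncomputable def sgn (z : ℝ) : ℝ := if 0 < z then 1 else -1

/-- interpret a Bool as ±1. -/
def pm (b : Bool) : ℝ := if b then 1 else -1

/-- probability of an event under the uniform distribution on {−1,1}^n. -/
noncomputable def unifPr (n : ℕ) (E : (Fin n → Bool) → Prop) : ℝ :=
  ((Finset.univ : Finset (Fin n → Bool)).filter E).card / 2 ^ n

/-- expectation under the uniform distribution on {−1,1}^n. -/
noncomputable def unifExp (n : ℕ) (g : (Fin n → Bool) → ℝ) : ℝ :=
  (∑ x : Fin n → Bool, g x) / 2 ^ n

/-- flip the i-th coordinate. -/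
def flipAt {n : ℕ} (i : Fin n) (x : Fin n → Bool) : Fin n → Bool :=
  Function.update x i (!(x i))

/-- influence of coordinate i. -/
noncomputable def infl {n : ℕ} (f : (Fin n → Bool) → ℝ) (i : Fin n) : ℝ :=
  unifPr n (fun x => f x ≠ f (flipAt i x))

/-- total influence. -/
noncomputable def totalInfl {n : ℕ} (f : (Fin n → Bool) → ℝ) : ℝ :=
  ∑ i, infl f i

/-- Fourier coefficient f̂(S). -/
noncomputable def fCoeff {n : ℕ} (f : (Fin n → Bool) → ℝ) (S : Finset (Fin n)) : ℝ :=
  unifExp n (fun x => f x * ∏ i ∈ S, pm (x i))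

/-- Fourier entropy with log base 2 (0 · log(1/0) is 0 by convention, which holds
definitionally since `Real.log 0 = 0` in Mathlib). -/
noncomputable def fourierEntropy {n : ℕ} (f : (Fin n → Bool) → ℝ) : ℝ :=
  ∑ S : Finset (Fin n), (fCoeff f S) ^ 2 * Real.logb 2 (1 / (fCoeff f S) ^ 2)

/-- The linear threshold function with weights w₀, w₁, …, w_n. -/
noncomputable def ltf (n : ℕ) (w : Fin (n + 1) → ℝ) : (Fin n → Bool) → ℝ :=
  fun x => sgn (w 0 + ∑ i : Fin n, w i.succ * pm (x i))
/-- The uniform probability measure on the interval [−1,1]. -/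
noncomputable def unifIcc : Measure ℝ :=
  (volume (Set.Icc (-1 : ℝ) 1))⁻¹ • volume.restrict (Set.Icc (-1 : ℝ) 1)


def bflip {n : ℕ} (B : Finset (Fin n)) (x : Fin n → Bool) : Fin n → Bool :=
  fun i => if i ∈ B then !(x i) else x i

lemma bflip_bflip {n : ℕ} (B : Finset (Fin n)) (x : Fin n → Bool) :
    bflip B (bflip B x) = x := by
  funext i; unfold bflip; split_ifs <;> simp

lemma sum_bflip {n : ℕ} (B : Finset (Fin n)) (g : (Fin n → Bool) → ℝ) :
    ∑ x, g (bflip B x) = ∑ x, g x :=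
  Equiv.sum_comp (Function.Involutive.toPerm (bflip B) (bflip_bflip B)) g

lemma unifExp_bflip {n : ℕ} (B : Finset (Fin n)) (g : (Fin n → Bool) → ℝ) :
    unifExp n (fun x => g (bflip B x)) = unifExp n g := by
  unfold unifExp; rw [sum_bflip]

lemma unifExp_add {n : ℕ} (g h : (Fin n → Bool) → ℝ) :
    unifExp n (fun x => g x + h x) = unifExp n g + unifExp n h := by
  unfold unifExp; rw [Finset.sum_add_distrib, add_div]

lemma unifExp_sub {n : ℕ} (g h : (Fin n → Bool) → ℝ) :
    unifExp n (fun x => g x - h x) = unifExp n g - unifExp n h := by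
  unfold unifExp; rw [Finset.sum_sub_distrib, sub_div]

lemma unifExp_mul {n : ℕ} (c : ℝ) (g : (Fin n → Bool) → ℝ) :
    unifExp n (fun x => c * g x) = c * unifExp n g := by
  unfold unifExp; rw [← Finset.mul_sum, mul_div_assoc]

lemma unifExp_const {n : ℕ} (c : ℝ) : unifExp n (fun _ => c) = c := by
  unfold unifExp; simp

lemma unifExp_sum {n : ℕ} {ι : Type*} (s : Finset ι) (g : ι → (Fin n → Bool) → ℝ) :
    unifExp n (fun x => ∑ i ∈ s, g i x) = ∑ i ∈ s, unifExp n (g i) := by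
  unfold unifExp; rw [Finset.sum_comm, Finset.sum_div]

lemma unifExp_mono {n : ℕ} {g h : (Fin n → Bool) → ℝ} (H : ∀ x, g x ≤ h x) :
    unifExp n g ≤ unifExp n h := by
  unfold unifExp; gcongr; exact H _

lemma pm_not (b : Bool) : pm (!b) = - pm b := by cases b <;> simp [pm]

lemma pm_sq (b : Bool) : pm b ^ 2 = 1 := by cases b <;> simp [pm]

lemma abs_pm (b : Bool) : |pm b| = 1 := by cases b <;> simp [pm]

/-- the character eigenvalue of the block flip. -/
def esign {n : ℕ} (S B : Finset (Fin n)) : ℝ := ∏ i ∈ S, if i ∈ B then (-1 : ℝ) else 1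

lemma chi_bflip {n : ℕ} (S B : Finset (Fin n)) (x : Fin n → Bool) :
    ∏ i ∈ S, pm (bflip B x i) = esign S B * ∏ i ∈ S, pm (x i) := by
  unfold esign
  rw [← Finset.prod_mul_distrib]
  refine Finset.prod_congr rfl fun i _ => ?_
  unfold bflip; split_ifs <;> simp [pm_not]

lemma sum_chi {n : ℕ} (x y : Fin n → Bool) :
    ∑ S : Finset (Fin n), (∏ i ∈ S, pm (x i)) * (∏ i ∈ S, pm (y i)) =
      if x = y then (2 : ℝ) ^ n else 0 := by
  have h : ∏ i : Fin n, (1 + pm (x i) * pm (y i)) =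
      ∑ S : Finset (Fin n), ∏ i ∈ S, (pm (x i) * pm (y i)) := by
    rw [Finset.prod_one_add, Finset.powerset_univ]
  simp_rw [← Finset.prod_mul_distrib]
  rw [← h]
  split_ifs with hxy
  · subst hxy
    have : ∀ i, 1 + pm (x i) * pm (x i) = 2 := fun i => by
      have := pm_sq (x i); nlinarith
    simp [this]
  · obtain ⟨i, hi⟩ := Function.ne_iff.mp hxy
    refine Finset.prod_eq_zero (Finset.mem_univ i) ?_
    cases hx : x i <;> cases hy : y i <;> simp_all [pm]

lemma plancherel {n : ℕ} (f : (Fin n → Bool) → ℝ) (B : Finset (Fin n)) :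
    ∑ S : Finset (Fin n), fCoeff f S ^ 2 * esign S B =
      unifExp n (fun x => f x * f (bflip B x)) := by
  have h1 : ∀ S : Finset (Fin n), fCoeff f S ^ 2 * esign S B =
      (∑ x, ∑ y, f x * f (bflip B y) *
        ((∏ i ∈ S, pm (x i)) * (∏ i ∈ S, pm (y i)))) / (2 ^ n * 2 ^ n) := by
    intro S
    have h2 : fCoeff f S * esign S B =
        unifExp n (fun y => f (bflip B y) * ∏ i ∈ S, pm (y i)) := by
      unfold fCoeff
      rw [← unifExp_bflip B, mul_comm, ← unifExp_mul]
      congr 1; funext y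
      rw [chi_bflip]
      have : esign S B * esign S B = 1 := by
        unfold esign
        rw [← Finset.prod_mul_distrib]
        refine Finset.prod_eq_one fun i _ => ?_
        split_ifs <;> norm_num
      linear_combination (f (bflip B y) * ∏ i ∈ S, pm (y i)) * this
    rw [sq, mul_assoc, h2]
    unfold fCoeff unifExp
    rw [div_mul_div_comm, Finset.sum_mul_sum]
    congr 1
    refine Finset.sum_congr rfl fun x _ => Finset.sum_congr rfl fun y _ => by ring
  simp_rw [h1]
  rw [← Finset.sum_div, Finset.sum_comm]
  have h3 : ∀ x : Fin n → Bool, ∑ S : Finset (Fin n), ∑ y, f x * f (bflip B y) *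
        ((∏ i ∈ S, pm (x i)) * (∏ i ∈ S, pm (y i))) = f x * f (bflip B x) * 2 ^ n := by
    intro x
    rw [Finset.sum_comm]
    simp_rw [← Finset.mul_sum, sum_chi]
    simp
  simp_rw [h3]
  unfold unifExp
  rw [← Finset.sum_mul]
  field_simp

lemma sgn_sq (z : ℝ) : sgn z * sgn z = 1 := by unfold sgn; split_ifs <;> norm_num
lemma sgn_mul_self (z : ℝ) : sgn z * z = |z| := by
  unfold sgn; split_ifs with h
  · rw [abs_of_pos h]; ring
  · rw [abs_of_nonpos (not_lt.mp h)]; ring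
lemma abs_sgn (z : ℝ) : |sgn z| = 1 := by unfold sgn; split_ifs <;> norm_num

lemma bflip_empty {n : ℕ} (x : Fin n → Bool) : bflip ∅ x = x := by
  funext i; simp [bflip]

lemma parseval {n : ℕ} (f : (Fin n → Bool) → ℝ) (hf : ∀ x, f x * f x = 1) :
    ∑ S : Finset (Fin n), fCoeff f S ^ 2 = 1 := by
  have := plancherel f ∅
  simp only [bflip_empty, hf, unifExp_const] at this
  simpa [esign] using this

/-- block part of the linear form -/
def blk {n : ℕ} (a : Fin n → ℝ) (B : Finset (Fin n)) (x : Fin n → Bool) : ℝ :=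
  ∑ i ∈ B, a i * pm (x i)

lemma blk_bflip_self {n : ℕ} (a : Fin n → ℝ) (B : Finset (Fin n)) (x : Fin n → Bool) :
    blk a B (bflip B x) = - blk a B x := by
  unfold blk
  rw [← Finset.sum_neg_distrib]
  refine Finset.sum_congr rfl fun i hi => ?_
  simp [bflip, hi, pm_not]

lemma blk_bflip_disj {n : ℕ} (a : Fin n → ℝ) (B T : Finset (Fin n)) (x : Fin n → Bool)
    (h : Disjoint T B) : blk a T (bflip B x) = blk a T x := by
  unfold blk
  refine Finset.sum_congr rfl fun i hi => ?_
  have : i ∉ B := Finset.disjoint_left.mp h hi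
  simp [bflip, this]

lemma blk_univ {n : ℕ} (a : Fin n → ℝ) (B : Finset (Fin n)) (x : Fin n → Bool) :
    ∑ i, a i * pm (x i) = blk a B x + blk a Bᶜ x := by
  unfold blk; rw [Finset.sum_add_sum_compl]

lemma ltf_block {n : ℕ} (w : Fin (n + 1) → ℝ) (B : Finset (Fin n)) :
    unifExp n (fun x => 1 - ltf n w x * ltf n w (bflip B x)) =
      2 * unifExp n (fun x => ltf n w x * SignType.sign (blk (fun i => w i.succ) B x)) := by
  set a : Fin n → ℝ := fun i => w i.succ with ha
  set s : (Fin n → Bool) → ℝ := fun x => SignType.sign (blk a B x) with hs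
  have e : ∀ x, 1 - ltf n w x * ltf n w (bflip B x) =
      ltf n w x * s x + ltf n w (bflip B x) * s (bflip B x) := by
    intro x
    have h1 : ltf n w x = sgn (w 0 + (blk a B x + blk a Bᶜ x)) := by
      unfold ltf; rw [← blk_univ]
    have h2 : ltf n w (bflip B x) = sgn (w 0 + (- blk a B x + blk a Bᶜ x)) := by
      unfold ltf; rw [← blk_bflip_self, ← blk_bflip_disj a B Bᶜ x disjoint_compl_left,
        ← blk_univ]
    have h3 : s (bflip B x) = SignType.sign (- blk a B x) := by
      simp only [hs]; rw [blk_bflip_self]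
    rw [h1, h2, h3]
    simp only [hs]
    generalize blk a B x = u
    generalize blk a Bᶜ x = v
    rcases lt_trichotomy u 0 with h | h | h
    · rw [sign_neg h, sign_pos (by linarith : 0 < -u)]
      unfold sgn; split_ifs <;> norm_num <;> linarith
    · subst h; simp [sgn_sq]
    · rw [sign_pos h, sign_neg (by linarith : -u < 0)]
      unfold sgn; split_ifs <;> norm_num <;> linarith
  simp_rw [e]
  rw [unifExp_add, unifExp_bflip B (fun x => ltf n w x * s x)]
  ring

lemma unifExp_sq_le {n : ℕ} (g : (Fin n → Bool) → ℝ) :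
    (unifExp n (fun x => |g x|)) ≤ √ (unifExp n (fun x => g x ^ 2)) := by
  apply Real.le_sqrt_of_sq_le
  set E := unifExp n (fun x => |g x|) with hE
  have h : 0 ≤ unifExp n (fun x => (|g x| - E) ^ 2) := by
    rw [← unifExp_const (n := n) 0]; exact unifExp_mono fun x => sq_nonneg _
  have key : ∀ c : ℝ, unifExp n (fun x => (|g x| - c) ^ 2) =
      unifExp n (fun x => g x ^ 2) - 2 * c * unifExp n (fun x => |g x|) + c ^ 2 := by
    intro c
    rw [← unifExp_mul, ← unifExp_sub]
    rw [show c ^ 2 = unifExp n (fun _ => c ^ 2) from (unifExp_const _).symm]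
    rw [← unifExp_add]
    congr 1; funext x
    rw [← sq_abs (g x)]; ring
  have h2 := key E
  rw [← hE] at h2
  nlinarith

lemma peres_block {n m : ℕ} (w : Fin (n + 1) → ℝ) (ρ : Fin n → Fin m) :
    ∑ b : Fin m, unifExp n (fun x => 1 - ltf n w x *
      ltf n w (bflip (Finset.univ.filter fun i => ρ i = b) x)) ≤ 2 * √ m := by
  set B : Fin m → Finset (Fin n) := fun b => Finset.univ.filter fun i => ρ i = b with hB
  set s : Fin m → (Fin n → Bool) → ℝ :=
    fun b x => SignType.sign (blk (fun i => w i.succ) (B b) x) with hs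
  have hdis : ∀ b c, b ≠ c → Disjoint (B b) (B c) := by
    intro b c hbc
    rw [Finset.disjoint_left]
    intro i; simp only [hB, Finset.mem_filter, Finset.mem_univ, true_and]
    intro h1 h2; exact hbc (h1.symm.trans h2)
  have h1 : ∀ b, unifExp n (fun x => 1 - ltf n w x * ltf n w (bflip (B b) x)) =
      2 * unifExp n (fun x => ltf n w x * s b x) := fun b => ltf_block w (B b)
  change ∑ b : Fin m, unifExp n (fun x => 1 - ltf n w x * ltf n w (bflip (B b) x)) ≤ _
  rw [Finset.sum_congr rfl fun b _ => h1 b]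
  rw [← Finset.mul_sum, ← unifExp_sum]
  have h2 : unifExp n (fun x => ∑ b, ltf n w x * s b x) ≤ unifExp n (fun x => |∑ b, s b x|) := by
    refine unifExp_mono fun x => ?_
    rw [← Finset.mul_sum]
    refine (le_abs_self _).trans ?_
    rw [abs_mul]
    unfold ltf; rw [abs_sgn, one_mul]
  have h3 := unifExp_sq_le (fun x => ∑ b, s b x)
  have h4 : unifExp n (fun x => (∑ b, s b x) ^ 2) ≤ m := by
    have e1 : ∀ x, (∑ b, s b x) ^ 2 = ∑ b, ∑ c, s b x * s c x := by
      intro x; rw [sq, Finset.sum_mul_sum]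
    simp_rw [e1]
    rw [unifExp_sum]
    have e2 : ∀ b, unifExp n (fun x => ∑ c, s b x * s c x) ≤ 1 := by
      intro b
      rw [unifExp_sum]
      rw [Finset.sum_eq_single b]
      · rw [← unifExp_const (n := n) 1]
        refine unifExp_mono fun x => ?_
        simp only [hs]
        rcases SignType.trichotomy (SignType.sign (blk (fun i => w i.succ) (B b) x)) with h | h | h <;>
          rw [h] <;> simp
      · intro c _ hcb
        have : unifExp n (fun x => s b x * s c x) = - unifExp n (fun x => s b x * s c x) := by
          nth_rewrite 1 [← unifExp_bflip (B b)]
          rw [neg_eq_neg_one_mul, ← unifExp_mul]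
          congr 1; funext x
          simp only [hs]
          rw [blk_bflip_self, blk_bflip_disj _ _ _ _ (hdis c b hcb), Left.sign_neg]
          simp
        linarith
      · simp
    calc _ ≤ ∑ b : Fin m, (1 : ℝ) := Finset.sum_le_sum fun b _ => e2 b
      _ = m := by simp
  have h5 := Real.sqrt_le_sqrt h4
  linarith

lemma sum_esign {n m : ℕ} (hm : 0 < m) (S : Finset (Fin n)) (b : Fin m) :
    ∑ ρ : Fin n → Fin m, esign S (Finset.univ.filter fun i => ρ i = b) =
      (m : ℝ) ^ n * (1 - 2 / m) ^ #S := by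
  have h1 : ∀ ρ : Fin n → Fin m, esign S (Finset.univ.filter fun i => ρ i = b) =
      ∏ i, (if i ∈ S then (if ρ i = b then (-1 : ℝ) else 1) else 1) := by
    intro ρ
    unfold esign
    simp only [Finset.mem_filter, Finset.mem_univ, true_and]
    symm
    rw [Finset.prod_ite_mem, Finset.univ_inter]
  simp_rw [h1]
  have h2 := Finset.prod_univ_sum (fun _ : Fin n => (Finset.univ : Finset (Fin m)))
    (fun i c => (if i ∈ S then (if c = b then (-1 : ℝ) else 1) else 1))
  rw [Fintype.piFinset_univ] at h2
  rw [← h2]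
  have h3 : ∀ i : Fin n, ∑ c : Fin m, (if i ∈ S then (if c = b then (-1 : ℝ) else 1) else 1) =
      m * (if i ∈ S then (1 - 2 / (m : ℝ)) else 1) := by
    intro i
    split_ifs with h
    · have : ∀ c : Fin m, (if c = b then (-1 : ℝ) else 1) = 1 - (if c = b then 2 else 0) := by
        intro c; split_ifs <;> norm_num
      simp_rw [this]
      rw [Finset.sum_sub_distrib]
      simp
      field_simp
    · simp
  simp_rw [h3]
  rw [Finset.prod_mul_distrib, Finset.prod_ite_mem, Finset.univ_inter]
  simp

lemma peres {n m : ℕ} (hm : 0 < m) (w : Fin (n + 1) → ℝ) :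
    ∑ S : Finset (Fin n), fCoeff (ltf n w) S ^ 2 * (1 - (1 - 2 / (m : ℝ)) ^ #S) ≤ 2 / √ m := by
  set f := ltf n w with hf
  have hff : ∀ x, f x * f x = 1 := fun x => sgn_sq _
  have h1 : ∀ B : Finset (Fin n), unifExp n (fun x => 1 - f x * f (bflip B x)) =
      ∑ S : Finset (Fin n), fCoeff f S ^ 2 * (1 - esign S B) := by
    intro B
    rw [unifExp_sub, unifExp_const, ← plancherel]
    simp_rw [mul_sub, mul_one]
    rw [Finset.sum_sub_distrib, parseval f hff]
  have h2 : ∑ ρ : Fin n → Fin m, ∑ b : Fin m, unifExp n (fun x => 1 - f x *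
      f (bflip (Finset.univ.filter fun i => ρ i = b) x)) ≤ ∑ ρ : Fin n → Fin m, 2 * √ m :=
    Finset.sum_le_sum fun ρ _ => peres_block w ρ
  simp_rw [h1] at h2
  have h3 : ∑ ρ : Fin n → Fin m, ∑ b : Fin m, ∑ S : Finset (Fin n), fCoeff f S ^ 2 *
      (1 - esign S (Finset.univ.filter fun i => ρ i = b)) =
      ((m : ℝ) ^ n * m) * ∑ S : Finset (Fin n), fCoeff f S ^ 2 * (1 - (1 - 2 / (m : ℝ)) ^ #S) := by
    rw [Finset.sum_comm]
    have : ∀ b : Fin m, ∑ ρ : Fin n → Fin m, ∑ S : Finset (Fin n), fCoeff f S ^ 2 *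
      (1 - esign S (Finset.univ.filter fun i => ρ i = b)) =
       (m : ℝ) ^ n * ∑ S : Finset (Fin n), fCoeff f S ^ 2 * (1 - (1 - 2 / (m : ℝ)) ^ #S) := by
      intro b
      rw [Finset.sum_comm, Finset.mul_sum]
      refine Finset.sum_congr rfl fun S _ => ?_
      rw [← Finset.mul_sum, Finset.sum_sub_distrib, sum_esign hm]
      simp
      ring
    simp_rw [this]
    simp
    ring
  rw [h3] at h2
  simp at h2
  have hm' : (0 : ℝ) < m := by exact_mod_cast hm
  have hs : 0 < √ (m : ℝ) := Real.sqrt_pos.mpr hm'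
  have hss := Real.mul_self_sqrt hm'.le
  rw [le_div_iff₀ hs]
  have hp : (0 : ℝ) < (m : ℝ) ^ n * √ m := by positivity
  refine le_of_mul_le_mul_left ?_ hp
  calc _ = (m : ℝ) ^ n * (√ m * √ m) * ∑ S : Finset (Fin n), fCoeff f S ^ 2 * (1 - (1 - 2 / (m : ℝ)) ^ #S) := by ring
    _ ≤ _ := by rw [hss]; linarith

lemma gibbs {ι : Type*} [Fintype ι] (p q : ι → ℝ) (hp : ∀ i, 0 ≤ p i) (hq : ∀ i, 0 < q i)
    (hp1 : ∑ i, p i = 1) (hq1 : ∑ i, q i ≤ 1) :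
    ∑ i, p i * Real.log (1 / p i) ≤ ∑ i, p i * Real.log (1 / q i) := by
  have h : ∀ i, p i * Real.log (1 / p i) ≤ p i * Real.log (1 / q i) + (q i - p i) := by
    intro i
    rcases (hp i).eq_or_lt with h0 | h0
    · rw [← h0]; simp; exact (hq i).le
    · have h1 : Real.log (q i / p i) ≤ q i / p i - 1 :=
        Real.log_le_sub_one_of_pos (div_pos (hq i) h0)
      rw [Real.log_div (hq i).ne' h0.ne'] at h1
      have h2 := mul_le_mul_of_nonneg_left h1 h0.le
      have h3 : p i * (q i / p i - 1) = q i - p i := by field_simp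
      rw [h3] at h2
      simp only [one_div, Real.log_inv]
      linarith
  calc _ ≤ ∑ i, (p i * Real.log (1 / q i) + (q i - p i)) := Finset.sum_le_sum fun i _ => h i
    _ = ∑ i, p i * Real.log (1 / q i) + (∑ i, q i - ∑ i, p i) := by
      rw [Finset.sum_add_distrib, Finset.sum_sub_distrib]
    _ ≤ _ := by rw [hp1]; linarith

lemma log_choose_le {n k : ℕ} (hk : 1 ≤ k) (hkn : k ≤ n) :
    Real.log (n.choose k) ≤ k * (1 + Real.log (n / k)) := by
  have hk' : (0 : ℝ) < k := by exact_mod_cast hk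
  have hn' : (0 : ℝ) < n := by exact_mod_cast (lt_of_lt_of_le hk hkn)
  have h1 : ((n.choose k : ℕ) : ℝ) ≤ (n : ℝ) ^ k / (k.factorial : ℝ) := Nat.choose_le_pow_div k n
  have h2 : (k : ℝ) ^ k / (k.factorial : ℝ) ≤ Real.exp k :=
    Real.pow_div_factorial_le_exp _ hk'.le k
  have h3 : ((n.choose k : ℕ) : ℝ) ≤ (n / k : ℝ) ^ k * Real.exp k := by
    calc _ ≤ (n : ℝ) ^ k / (k.factorial : ℝ) := h1
      _ = (n / k : ℝ) ^ k * ((k : ℝ) ^ k / (k.factorial : ℝ)) := by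
        rw [div_pow]; field_simp
      _ ≤ _ := by gcongr
  have hpos : (0 : ℝ) < n.choose k := by exact_mod_cast Nat.choose_pos hkn
  have h4 := Real.log_le_log hpos h3
  rw [Real.log_mul (by positivity) (by positivity), Real.log_exp, Real.log_pow] at h4
  linarith

lemma four_add_three (t : ℕ) : (4 + 3 * t : ℝ) ≤ 4 * 2 ^ t := by
  have : 1 + (t : ℝ) * 1 ≤ (1 + 1) ^ t := one_add_mul_le_pow (by norm_num) t
  norm_num at this
  nlinarith [(Nat.cast_nonneg t : (0 : ℝ) ≤ t)]

lemma T_nonneg (j k : ℕ) : 0 ≤ 1 - (1 - 1 / (16 : ℝ) ^ j) ^ k := by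
  have h1 : 1 / (16 : ℝ) ^ j ≤ 1 := by
    rw [div_le_one (by positivity)]; exact one_le_pow₀ (by norm_num)
  have h2 : 0 < 1 / (16 : ℝ) ^ j := by positivity
  have := pow_le_one₀ (n := k) (by linarith : 0 ≤ 1 - 1 / (16 : ℝ) ^ j) (by linarith)
  linarith

lemma log_sixteen : Real.log 16 ≤ 3 := by
  have : (16 : ℝ) ≤ Real.exp 3 := by
    have h := Real.exp_one_gt_d9
    have : Real.exp 3 = Real.exp 1 ^ 3 := by rw [← Real.exp_nat_mul]; norm_num
    rw [this]
    calc (16 : ℝ) ≤ 2.7 ^ 3 := by norm_num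
      _ ≤ _ := by gcongr; linarith
  calc _ ≤ Real.log (Real.exp 3) := Real.log_le_log (by norm_num) this
    _ = 3 := Real.log_exp 3

lemma level_bound {n k J : ℕ} (hkn : k ≤ n) (hJ : n < 16 ^ (J + 1)) :
    Real.log (n.choose k) ≤ 128 * 2 ^ J *
      ∑ j ∈ Finset.range (J + 1), (8 : ℝ) ^ j * (1 - (1 - 1 / (16 : ℝ) ^ j) ^ k) := by
  rcases Nat.eq_zero_or_pos k with h0 | hk
  · subst h0; simp
  have hn : 0 < n := lt_of_lt_of_le hk hkn
  have hk' : (0 : ℝ) < k := by exact_mod_cast hk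
  have hn' : (0 : ℝ) < n := by exact_mod_cast hn
  set j := Nat.log 16 k with hj
  have a1 : 16 ^ j ≤ k := Nat.pow_log_le_self 16 hk.ne'
  have a2 : k < 16 ^ (j + 1) := Nat.lt_pow_succ_log_self (by norm_num) k
  have hjJ : j ≤ J := by
    have : 16 ^ j < 16 ^ (J + 1) := by omega
    have := (Nat.pow_lt_pow_iff_right (by norm_num : 1 < 16)).mp this
    omega
  obtain ⟨t, rfl⟩ := Nat.exists_eq_add_of_le hjJ
  have b1 : (16 : ℝ) ^ j ≤ k := by exact_mod_cast a1
  have b2 : (k : ℝ) ≤ 16 ^ (j + 1) := by exact_mod_cast a2.le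
  have b3 : (n : ℝ) ≤ 16 ^ (j + t + 1) := by exact_mod_cast hJ.le
  have hT : (1 : ℝ) / 2 ≤ 1 - (1 - 1 / (16 : ℝ) ^ j) ^ k := by
    have c1 : 1 / (16 : ℝ) ^ j ≤ 1 := by
      rw [div_le_one (by positivity)]; exact one_le_pow₀ (by norm_num)
    have c2 : (1 - 1 / (16 : ℝ) ^ j) ^ k ≤ Real.exp (-(1 / (16 : ℝ) ^ j)) ^ k := by
      exact pow_le_pow_left₀ (by linarith) (Real.one_sub_le_exp_neg _) k
    rw [← Real.exp_nat_mul] at c2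
    have c3 : (k : ℝ) * -(1 / (16 : ℝ) ^ j) ≤ -1 := by
      have : 1 ≤ (k : ℝ) / 16 ^ j := by rw [le_div_iff₀ (by positivity)]; linarith
      calc _ = -((k : ℝ) / 16 ^ j) := by ring
        _ ≤ _ := by linarith
    have c4 := Real.exp_le_exp.mpr c3
    have c5 : Real.exp (-1) ≤ 1 / 2 := by
      rw [Real.exp_neg, ← one_div]
      apply one_div_le_one_div_of_le (by norm_num)
      linarith [Real.add_one_le_exp 1]
    linarith
  have hsum : (8 : ℝ) ^ j * (1 / 2) ≤
      ∑ j ∈ Finset.range (j + t + 1), (8 : ℝ) ^ j * (1 - (1 - 1 / (16 : ℝ) ^ j) ^ k) := by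
    refine le_trans ?_ (Finset.single_le_sum
      (f := fun j => (8 : ℝ) ^ j * (1 - (1 - 1 / (16 : ℝ) ^ j) ^ k)) (fun i _ => ?_)
      (Finset.mem_range.mpr (by omega : j < j + t + 1)))
    · gcongr
    · exact mul_nonneg (by positivity) (T_nonneg _ _)
  have hlog : Real.log (n / k) ≤ 3 * (t + 1) := by
    have d1 : (n : ℝ) / k ≤ 16 ^ (t + 1) := by
      rw [div_le_iff₀ hk']
      calc (n : ℝ) ≤ 16 ^ (j + t + 1) := b3
        _ = 16 ^ (t + 1) * 16 ^ j := by ring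
        _ ≤ _ := by gcongr
    have d2 := Real.log_le_log (by positivity) d1
    rw [Real.log_pow] at d2
    push_cast at d2
    nlinarith [log_sixteen, (Nat.cast_nonneg t : (0 : ℝ) ≤ t)]
  calc Real.log (n.choose k) ≤ k * (1 + Real.log (n / k)) := log_choose_le hk hkn
    _ ≤ k * (4 * 2 ^ t) := by
      gcongr
      linarith [four_add_three t]
    _ ≤ 16 ^ (j + 1) * (4 * 2 ^ t) := by gcongr
    _ = 128 * 2 ^ (j + t) * ((8 : ℝ) ^ j * (1 / 2)) := by
      have : (16 : ℝ) ^ j = 2 ^ j * 8 ^ j := by rw [← mul_pow]; norm_num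
      rw [pow_succ, pow_add, this]; ring
    _ ≤ _ := by gcongr

lemma sum_inv_choose (n : ℕ) :
    ∑ S : Finset (Fin n), 1 / (((n : ℝ) + 1) * (n.choose #S : ℝ)) ≤ 1 := by
  have h := Finset.sum_powerset_apply_card (fun k => 1 / (((n : ℝ) + 1) * (n.choose k : ℝ)))
    (x := (Finset.univ : Finset (Fin n)))
  rw [Finset.powerset_univ] at h
  rw [h]
  simp only [Finset.card_univ, Fintype.card_fin, nsmul_eq_mul]
  have : ∀ k ∈ Finset.range (n + 1),
      (n.choose k : ℝ) * (1 / (((n : ℝ) + 1) * (n.choose k : ℝ))) = 1 / ((n : ℝ) + 1) := by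
    intro k hk
    have : (0 : ℝ) < n.choose k := by
      exact_mod_cast Nat.choose_pos (by simpa [Nat.lt_succ_iff] using hk)
    field_simp
  rw [Finset.sum_congr rfl this]
  simp
  rw [mul_inv_cancel₀ (by positivity)]

lemma entropy_le {n : ℕ} (hn : 1 ≤ n) (w : Fin (n + 1) → ℝ) :
    fourierEntropy (ltf n w) ≤ 1028 * √ n := by
  set f := ltf n w with hf
  have hpar : ∑ S : Finset (Fin n), fCoeff f S ^ 2 = 1 := parseval f fun x => sgn_sq _
  have hchoose : ∀ S : Finset (Fin n), (0 : ℝ) < n.choose #S := fun S => by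
    exact_mod_cast Nat.choose_pos (by simpa using Finset.card_le_univ S)
  have hg := gibbs (fun S : Finset (Fin n) => fCoeff f S ^ 2)
    (fun S => 1 / (((n : ℝ) + 1) * (n.choose #S : ℝ))) (fun S => sq_nonneg _)
    (fun S => by have := hchoose S; positivity) hpar (sum_inv_choose n)
  have h1 : ∑ S : Finset (Fin n), fCoeff f S ^ 2 *
      Real.log (1 / (1 / (((n : ℝ) + 1) * (n.choose #S : ℝ)))) =
      Real.log ((n : ℝ) + 1) + ∑ S : Finset (Fin n), fCoeff f S ^ 2 * Real.log (n.choose #S) := by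
    have : ∀ S : Finset (Fin n), fCoeff f S ^ 2 *
      Real.log (1 / (1 / (((n : ℝ) + 1) * (n.choose #S : ℝ)))) =
       fCoeff f S ^ 2 * Real.log ((n : ℝ) + 1) + fCoeff f S ^ 2 * Real.log (n.choose #S) := by
      intro S
      rw [one_div_one_div, Real.log_mul (by positivity) (hchoose S).ne']; ring
    simp_rw [this]
    rw [Finset.sum_add_distrib, ← Finset.sum_mul, hpar, one_mul]
  set J := Nat.log 16 n with hJ
  have a1 : 16 ^ J ≤ n := Nat.pow_log_le_self 16 (by omega)
  have a2 : n < 16 ^ (J + 1) := Nat.lt_pow_succ_log_self (by norm_num) n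
  have h2 : ∑ S : Finset (Fin n), fCoeff f S ^ 2 * Real.log (n.choose #S) ≤
      ∑ S : Finset (Fin n), fCoeff f S ^ 2 * (128 * 2 ^ J *
      ∑ j ∈ Finset.range (J + 1), (8 : ℝ) ^ j * (1 - (1 - 1 / (16 : ℝ) ^ j) ^ #S)) := by
    refine Finset.sum_le_sum fun S _ => ?_
    refine mul_le_mul_of_nonneg_left ?_ (sq_nonneg _)
    exact level_bound (by simpa using Finset.card_le_univ S) a2
  have h3 : ∑ S : Finset (Fin n), fCoeff f S ^ 2 * (128 * 2 ^ J *
      ∑ j ∈ Finset.range (J + 1), (8 : ℝ) ^ j * (1 - (1 - 1 / (16 : ℝ) ^ j) ^ #S)) =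
      128 * 2 ^ J * ∑ j ∈ Finset.range (J + 1), (8 : ℝ) ^ j *
        ∑ S : Finset (Fin n), fCoeff f S ^ 2 * (1 - (1 - 1 / (16 : ℝ) ^ j) ^ #S) := by
    simp_rw [Finset.mul_sum]
    rw [Finset.sum_comm]
    refine Finset.sum_congr rfl fun j _ => Finset.sum_congr rfl fun S _ => by ring
  have h4 : ∀ j, (8 : ℝ) ^ j *
        ∑ S : Finset (Fin n), fCoeff f S ^ 2 * (1 - (1 - 1 / (16 : ℝ) ^ j) ^ #S) ≤ 2 * 2 ^ j := by
    intro j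
    have hp := peres (m := 2 * 16 ^ j) (by positivity) w
    push_cast at hp
    have e1 : (2 : ℝ) / (2 * 16 ^ j) = 1 / 16 ^ j := by field_simp
    rw [e1] at hp
    have e2 : (4 : ℝ) ^ j ≤ √ (2 * 16 ^ j) := by
      apply Real.le_sqrt_of_sq_le
      rw [← pow_mul, mul_comm j 2, pow_mul]
      norm_num
    have e3 : (2 : ℝ) / √ (2 * 16 ^ j) ≤ 2 / 4 ^ j := by gcongr
    calc _ ≤ (8 : ℝ) ^ j * (2 / 4 ^ j) := by
          refine mul_le_mul_of_nonneg_left (hp.trans e3) (by positivity)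
      _ = 2 * 2 ^ j := by
        have : (8 : ℝ) ^ j = 2 ^ j * 4 ^ j := by rw [← mul_pow]; norm_num
        rw [this]; field_simp
  have h5 : ∑ j ∈ Finset.range (J + 1), (8 : ℝ) ^ j *
        ∑ S : Finset (Fin n), fCoeff f S ^ 2 * (1 - (1 - 1 / (16 : ℝ) ^ j) ^ #S) ≤ 4 * 2 ^ J := by
    calc _ ≤ ∑ j ∈ Finset.range (J + 1), 2 * (2 : ℝ) ^ j := Finset.sum_le_sum fun j _ => h4 j
      _ = 2 * (2 ^ (J + 1) - 1) := by
        rw [← Finset.mul_sum, geom_sum_eq (by norm_num)]; norm_num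
      _ ≤ _ := by rw [pow_succ]; linarith
  have h6 : (2 : ℝ) ^ J * 2 ^ J ≤ √ n := by
    apply Real.le_sqrt_of_sq_le
    have : ((2 : ℝ) ^ J * 2 ^ J) ^ 2 = 16 ^ J := by
      rw [← mul_pow, ← pow_mul, mul_comm J 2, pow_mul]; norm_num
    rw [this]; exact_mod_cast a1
  have h7 : Real.log ((n : ℝ) + 1) ≤ 2 * √ n := by
    have hs := Real.sqrt_nonneg (n : ℝ)
    have hss := Real.sq_sqrt (Nat.cast_nonneg n : (0 : ℝ) ≤ n)
    calc _ ≤ Real.log ((√ n + 1) ^ 2) := Real.log_le_log (by positivity) (by nlinarith)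
      _ = 2 * Real.log (√ n + 1) := by rw [Real.log_pow]; norm_num
      _ ≤ _ := by
        have := Real.log_le_sub_one_of_pos (by positivity : 0 < √ (n : ℝ) + 1)
        linarith
  have h8 : ∑ S : Finset (Fin n), fCoeff f S ^ 2 * Real.log (1 / fCoeff f S ^ 2) ≤ 514 * √ n := by
    have : 128 * 2 ^ J * ∑ j ∈ Finset.range (J + 1), (8 : ℝ) ^ j *
        ∑ S : Finset (Fin n), fCoeff f S ^ 2 * (1 - (1 - 1 / (16 : ℝ) ^ j) ^ #S) ≤
        128 * 2 ^ J * (4 * 2 ^ J) := by gcongr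
    have e : (128 : ℝ) * 2 ^ J * (4 * 2 ^ J) = 512 * (2 ^ J * 2 ^ J) := by ring
    linarith
  have h9 : fourierEntropy f =
      (∑ S : Finset (Fin n), fCoeff f S ^ 2 * Real.log (1 / fCoeff f S ^ 2)) / Real.log 2 := by
    unfold fourierEntropy Real.logb
    rw [Finset.sum_div]
    refine Finset.sum_congr rfl fun S _ => by ring
  have hl : 1 / 2 ≤ Real.log 2 := by linarith [Real.log_two_gt_d9]
  rw [h9, div_le_iff₀ (by linarith)]
  nlinarith [Real.sqrt_nonneg (n : ℝ)]

lemma bflip_singleton {n : ℕ} (i : Fin n) (x : Fin n → Bool) : bflip {i} x = flipAt i x := by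
  funext j
  unfold bflip flipAt
  by_cases h : j = i
  · subst h; simp
  · simp [h]

lemma unifPr_eq {n : ℕ} (E : (Fin n → Bool) → Prop) :
    unifPr n E = unifExp n (fun x => if E x then 1 else 0) := by
  unfold unifPr unifExp
  rw [Finset.sum_boole]

lemma coeff_le_infl {n : ℕ} (f : (Fin n → Bool) → ℝ) (hf : ∀ x, |f x| = 1) (i : Fin n)
    (a : ℝ) (ha : |a| ≤ 1) :
    unifExp n (fun x => f x * (a * pm (x i))) ≤ infl f i := by
  unfold infl
  rw [unifPr_eq]
  have h1 : unifExp n (fun x => f x * (a * pm (x i))) =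
      unifExp n (fun x => (f x - f (flipAt i x)) * (a * pm (x i)) / 2) := by
    have e1 := unifExp_bflip {i} (fun x => f x * (a * pm (x i)))
    have e2 : unifExp n (fun x => (f x - f (flipAt i x)) * (a * pm (x i)) / 2) =
      (1 / 2) * (unifExp n (fun x => f x * (a * pm (x i))) +
        unifExp n (fun x => f (bflip {i} x) * (a * pm (bflip {i} x i)))) := by
      rw [← unifExp_add, ← unifExp_mul]
      congr 1; funext x
      rw [← bflip_singleton]
      have : pm (bflip {i} x i) = - pm (x i) := by simp [bflip, pm_not]
      rw [this]; ring
    rw [e2, e1]; ring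
  rw [h1]
  refine unifExp_mono fun x => ?_
  split_ifs with h
  · have b1 : |f x - f (flipAt i x)| ≤ 2 := by
      refine (abs_sub _ _).trans ?_
      rw [hf, hf]; norm_num
    have b2 : |a * pm (x i)| ≤ 1 := by rw [abs_mul, abs_pm, mul_one]; exact ha
    have b3 : |(f x - f (flipAt i x)) * (a * pm (x i))| ≤ 2 * 1 := by
      rw [abs_mul]; gcongr
    have := le_abs_self ((f x - f (flipAt i x)) * (a * pm (x i)))
    linarith
  · have : f x = f (flipAt i x) := not_not.mp h
    rw [← this]; simp

lemma moments {n : ℕ} (a : Fin n → ℝ) (T : Finset (Fin n)) :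
    unifExp n (fun x => blk a T x ^ 2) = ∑ i ∈ T, a i ^ 2 ∧
    unifExp n (fun x => blk a T x ^ 4) ≤ 3 * (∑ i ∈ T, a i ^ 2) ^ 2 := by
  induction T using Finset.induction_on with
  | empty => simp [blk, unifExp_const]
  | insert i T hi ih =>
    have hb : ∀ x, blk a (insert i T) x = a i * pm (x i) + blk a T x := fun x => by
      unfold blk; rw [Finset.sum_insert hi]
    have hb' : ∀ x, blk a (insert i T) (bflip {i} x) = - (a i * pm (x i)) + blk a T x := fun x => by
      rw [hb, blk_bflip_disj a {i} T x (by simpa using hi)]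
      have : pm (bflip {i} x i) = - pm (x i) := by simp [bflip, pm_not]
      rw [this]; ring
    have key : ∀ k : ℕ, unifExp n (fun x => blk a (insert i T) x ^ k) =
        unifExp n (fun x => (1 / 2) * ((a i * pm (x i) + blk a T x) ^ k +
          (- (a i * pm (x i)) + blk a T x) ^ k)) := by
      intro k
      rw [unifExp_mul, unifExp_add]
      have := unifExp_bflip {i} (fun x => blk a (insert i T) x ^ k)
      simp_rw [hb'] at this
      rw [this]
      simp_rw [hb]; ring
    have hsq : ∀ x : Fin n → Bool, (a i * pm (x i)) ^ 2 = a i ^ 2 := fun x => by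
      rw [mul_pow, pm_sq, mul_one]
    have k2 : ∀ x : Fin n → Bool, (1 / 2) * ((a i * pm (x i) + blk a T x) ^ 2 +
          (- (a i * pm (x i)) + blk a T x) ^ 2) = a i ^ 2 + blk a T x ^ 2 := fun x => by
      rw [← hsq x]; ring
    have k4 : ∀ x : Fin n → Bool, (1 / 2) * ((a i * pm (x i) + blk a T x) ^ 4 +
          (- (a i * pm (x i)) + blk a T x) ^ 4) =
          (a i ^ 2) ^ 2 + (6 * a i ^ 2 * blk a T x ^ 2 + blk a T x ^ 4) := fun x => by
      rw [← hsq x]; ring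
    rw [key 2, key 4]
    simp_rw [k2, k4]
    rw [unifExp_add, unifExp_add, unifExp_add, unifExp_mul, unifExp_const, unifExp_const,
      Finset.sum_insert hi, ih.1]
    refine ⟨rfl, ?_⟩
    nlinarith [ih.2, sq_nonneg (a i ^ 2)]

lemma khintchine {n : ℕ} (a : Fin n → ℝ) :
    √ (∑ i, a i ^ 2) / 4 ≤ unifExp n (fun x => |∑ i, a i * pm (x i)|) := by
  have hm := moments a Finset.univ
  set V := ∑ i, a i ^ 2 with hV
  have hV0 : 0 ≤ V := Finset.sum_nonneg fun i _ => sq_nonneg _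
  rcases hV0.eq_or_lt with h0 | hpos
  · rw [← h0]; simp
    rw [← unifExp_const (n := n) 0]; exact unifExp_mono fun x => abs_nonneg _
  set s := √ V with hs
  have hs0 : 0 < s := Real.sqrt_pos.mpr hpos
  have hss : s ^ 2 = V := Real.sq_sqrt hV0
  have pt : ∀ y : ℝ, (1 / s) * y ^ 2 - (1 / (4 * s ^ 3)) * y ^ 4 ≤ |y| := by
    intro y
    have e : (1 / s) * y ^ 2 - (1 / (4 * s ^ 3)) * y ^ 4 =
        s * ((|y| / s) ^ 2 - (|y| / s) ^ 4 / 4) := by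
      rw [div_pow, div_pow, sq_abs, show |y| ^ 4 = y ^ 4 from by
        rw [show (4 : ℕ) = 2 * 2 from rfl, pow_mul, pow_mul, sq_abs]]
      field_simp
    have e2 : |y| = s * (|y| / s) := by field_simp
    rw [e]
    nth_rewrite 3 [e2]
    refine mul_le_mul_of_nonneg_left ?_ hs0.le
    have hu : 0 ≤ |y| / s := by positivity
    generalize |y| / s = u at hu
    have : 0 ≤ 1 - u + u ^ 3 / 4 := by
      nlinarith [mul_nonneg hu (sq_nonneg (u - 1)), sq_nonneg (u - 1)]
    nlinarith [mul_nonneg hu this]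
  have h1 : unifExp n (fun x => (1 / s) * blk a Finset.univ x ^ 2 -
      (1 / (4 * s ^ 3)) * blk a Finset.univ x ^ 4) ≤
      unifExp n (fun x => |∑ i, a i * pm (x i)|) := unifExp_mono fun x => pt _
  rw [unifExp_sub, unifExp_mul, unifExp_mul, hm.1] at h1
  have h2 : (1 / (4 * s ^ 3)) * unifExp n (fun x => blk a Finset.univ x ^ 4) ≤
      (1 / (4 * s ^ 3)) * (3 * V ^ 2) := by
    gcongr; exact hm.2
  have h3 : (1 / s) * V - (1 / (4 * s ^ 3)) * (3 * V ^ 2) = s / 4 := by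
    rw [← hss]; field_simp; ring
  linarith

lemma infl_ge {n : ℕ} (w : Fin (n + 1) → ℝ) (hw : ∀ i, |w i| ≤ 1) :
    √ (∑ i : Fin n, w i.succ ^ 2) / 4 - 2 ≤ totalInfl (ltf n w) := by
  have h1 : unifExp n (fun x => ∑ i : Fin n, ltf n w x * (w i.succ * pm (x i))) ≤
      totalInfl (ltf n w) := by
    rw [unifExp_sum]
    unfold totalInfl
    exact Finset.sum_le_sum fun i _ =>
      coeff_le_infl (ltf n w) (fun x => abs_sgn _) i _ (hw _)
  have h2 : unifExp n (fun x => |∑ i : Fin n, w i.succ * pm (x i)| - 2) ≤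
      unifExp n (fun x => ∑ i : Fin n, ltf n w x * (w i.succ * pm (x i))) := by
    refine unifExp_mono fun x => ?_
    rw [← Finset.mul_sum]
    set Y := ∑ i : Fin n, w i.succ * pm (x i) with hY
    have e1 : ltf n w x * (w 0 + Y) = |w 0 + Y| := sgn_mul_self _
    have e2 : |Y| ≤ |w 0 + Y| + |w 0| := by
      have := abs_sub (w 0 + Y) (w 0)
      rwa [add_sub_cancel_left] at this
    have e3 : |ltf n w x * w 0| ≤ 1 := by
      rw [abs_mul, show |ltf n w x| = 1 from abs_sgn _, one_mul]; exact hw 0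
    have e4 := (abs_le.mp e3).2
    have := hw 0
    linarith
  rw [unifExp_sub, unifExp_const] at h2
  have := khintchine (fun i : Fin n => w i.succ)
  linarith

lemma fei_of_good {n : ℕ} (hn : 1000000 ≤ n) (w : Fin (n + 1) → ℝ) (hw : ∀ i, |w i| ≤ 1)
    (hs : (n : ℝ) / 12 < ∑ i, w i ^ 2) :
    fourierEntropy (ltf n w) ≤ 100000 * totalInfl (ltf n w) := by
  have h1 := entropy_le (by omega : 1 ≤ n) w
  have h2 := infl_ge w hw
  rw [Fin.sum_univ_succ] at hs
  have h0 : w 0 ^ 2 ≤ 1 := by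
    rw [← sq_abs]; nlinarith [hw 0, abs_nonneg (w 0)]
  have hn' : (1000000 : ℝ) ≤ n := by exact_mod_cast hn
  have h3 : √ (n : ℝ) / 10 ≤ √ (∑ i : Fin n, w i.succ ^ 2) := by
    apply Real.le_sqrt_of_sq_le
    rw [div_pow, Real.sq_sqrt (by positivity)]
    linarith
  have h4 : (1000 : ℝ) ≤ √ n := by
    apply Real.le_sqrt_of_sq_le; linarith
  linarith

instance unifIcc_prob : IsProbabilityMeasure unifIcc := by
  constructor
  unfold unifIcc
  simp only [Measure.smul_apply, Measure.restrict_apply MeasurableSet.univ, Set.univ_inter,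
    smul_eq_mul]
  rw [Real.volume_Icc]
  apply ENNReal.inv_mul_cancel <;> norm_num

lemma unifIcc_ae : ∀ᵐ x ∂unifIcc, |x| ≤ 1 := by
  unfold unifIcc
  apply Measure.ae_smul_measure
  filter_upwards [ae_restrict_mem measurableSet_Icc] with x hx
  exact abs_le.mpr hx

lemma unifIcc_exp : ∫ x, Real.exp (-x ^ 2) ∂unifIcc ≤ Real.exp (-(1 / 6)) := by
  have h1 : ∫ x, Real.exp (-x ^ 2) ∂unifIcc =
      (1 / 2) * ∫ x in (-1 : ℝ)..1, Real.exp (-x ^ 2) := by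
    unfold unifIcc
    rw [integral_smul_measure, intervalIntegral.integral_of_le (by norm_num),
      integral_Icc_eq_integral_Ioc, Real.volume_Icc]
    norm_num
  have h2 : ∫ x in (-1 : ℝ)..1, Real.exp (-x ^ 2) ≤ ∫ x in (-1 : ℝ)..1, (1 - x ^ 2 / 2) := by
    apply intervalIntegral.integral_mono_on (by norm_num)
    · exact Continuous.intervalIntegrable (by fun_prop) _ _
    · exact Continuous.intervalIntegrable (by fun_prop) _ _
    · intro x hx
      have hx2 : x ^ 2 ≤ 1 := by nlinarith [hx.1, hx.2]
      have a1 := Real.add_one_le_exp (x ^ 2)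
      have a2 : 0 ≤ x ^ 2 := sq_nonneg x
      rw [Real.exp_neg, ← one_div, div_le_iff₀ (Real.exp_pos _)]
      nlinarith
  have h3 : ∫ x in (-1 : ℝ)..1, (1 - x ^ 2 / 2) = 5 / 3 := by
    rw [intervalIntegral.integral_sub (by simp)
      (Continuous.intervalIntegrable (by fun_prop) _ _)]
    simp [integral_pow]
    norm_num
  have h4 := Real.one_sub_le_exp_neg (1 / 6)
  rw [h1]
  linarith

lemma measure_bad (n : ℕ) :
    (Measure.pi fun _ : Fin (n + 1) => unifIcc).real
      {w : Fin (n + 1) → ℝ | ∑ i, w i ^ 2 ≤ (n : ℝ) / 12} ≤ Real.exp (-(1 / 12) * n) := by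
  set μ := Measure.pi fun _ : Fin (n + 1) => unifIcc with hμ
  have hint : Integrable (fun w : Fin (n + 1) → ℝ => Real.exp (-∑ i, w i ^ 2)) μ := by
    refine Integrable.of_bound (C := 1)
      (Continuous.aestronglyMeasurable (by fun_prop)) (ae_of_all _ fun w => ?_)
    rw [Real.norm_eq_abs, abs_of_pos (Real.exp_pos _)]
    apply Real.exp_le_one_iff.mpr
    have : 0 ≤ ∑ i, w i ^ 2 := Finset.sum_nonneg fun i _ => sq_nonneg _
    linarith
  have hE : ∫ w, Real.exp (-∑ i, w i ^ 2) ∂μ ≤ Real.exp (-(1 / 6)) ^ (n + 1) := by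
    have : ∀ w : Fin (n + 1) → ℝ, Real.exp (-∑ i, w i ^ 2) = ∏ i, Real.exp (-(w i) ^ 2) := by
      intro w; rw [← Real.exp_sum, Finset.sum_neg_distrib]
    simp_rw [this]
    rw [hμ, integral_fintype_prod_eq_prod (fun (_ : Fin (n + 1)) (x : ℝ) => Real.exp (-x ^ 2))]
    simp only [Finset.prod_const, Finset.card_univ, Fintype.card_fin]
    have h0 : 0 ≤ ∫ x, Real.exp (-x ^ 2) ∂unifIcc := integral_nonneg fun x => (Real.exp_pos _).le
    gcongr
    exact unifIcc_exp
  have hM := mul_meas_ge_le_integral_of_nonneg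
    (ae_of_all μ fun w : Fin (n + 1) → ℝ => (Real.exp_pos (-∑ i, w i ^ 2)).le) hint
    (Real.exp (-(n / 12 : ℝ)))
  have hset : {w : Fin (n + 1) → ℝ | Real.exp (-(n / 12 : ℝ)) ≤ Real.exp (-∑ i, w i ^ 2)} =
      {w : Fin (n + 1) → ℝ | ∑ i, w i ^ 2 ≤ (n : ℝ) / 12} := by
    ext w; simp
  rw [hset] at hM
  have h5 : Real.exp (-(1 / 6)) ^ (n + 1) ≤
      Real.exp (-(n / 12 : ℝ)) * Real.exp (-(1 / 12) * n) := by
    rw [← Real.exp_nat_mul, ← Real.exp_add]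
    apply Real.exp_le_exp.mpr
    push_cast
    linarith
  exact le_of_mul_le_mul_left (hM.trans (hE.trans h5)) (Real.exp_pos _)

/-- the FEI inequality holds with probability 1 − e^{−Ω(n)} for a
random LTF with i.i.d. uniform [−1,1] weights. -/
theorem random_uniform_ltf_fei :
    ∃ C c : ℝ, 0 < C ∧ 0 < c ∧ ∃ N : ℕ, ∀ n : ℕ, N ≤ n →
      (Measure.pi fun _ : Fin (n + 1) => unifIcc)
          {w : Fin (n + 1) → ℝ | fourierEntropy (ltf n w) ≤ C * totalInfl (ltf n w)} ≥
        ENNReal.ofReal (1 - Real.exp (-c * n)) := by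
  refine ⟨100000, 1 / 12, by norm_num, by norm_num, 1000000, fun n hn => ?_⟩
  set μ := Measure.pi fun _ : Fin (n + 1) => unifIcc with hμ
  have hae : ∀ᵐ w ∂μ, ∀ i, |w i| ≤ 1 := by
    rw [ae_all_iff]
    intro i
    exact (Measure.quasiMeasurePreserving_eval (μ := fun _ : Fin (n + 1) => unifIcc) i).ae
      unifIcc_ae
  have hmeas : MeasurableSet {w : Fin (n + 1) → ℝ | ∑ i, w i ^ 2 ≤ (n : ℝ) / 12} :=
    measurableSet_le (by fun_prop) (by fun_prop)
  have h1 : μ ({w : Fin (n + 1) → ℝ | ∑ i, w i ^ 2 ≤ (n : ℝ) / 12}ᶜ) ≤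
      μ {w : Fin (n + 1) → ℝ | fourierEntropy (ltf n w) ≤ 100000 * totalInfl (ltf n w)} := by
    apply measure_mono_ae
    filter_upwards [hae] with w hw hs
    exact fei_of_good hn w hw (not_le.mp hs)
  refine le_trans ?_ h1
  have h2 := measure_bad n
  have h3 : μ.real ({w : Fin (n + 1) → ℝ | ∑ i, w i ^ 2 ≤ (n : ℝ) / 12}ᶜ) =
      1 - μ.real {w : Fin (n + 1) → ℝ | ∑ i, w i ^ 2 ≤ (n : ℝ) / 12} := probReal_compl_eq_one_sub hmeas
  rw [← ofReal_measureReal, h3]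
  apply ENNReal.ofReal_le_ofReal
  linarith
end

section
/- Let M ≥ 1 and let D be a probability distribution on ℝ supported in [−M, M] with E_{w∼D}[w²] = 1. Let w₀, w₁, …, w_n be independent random variables each with distribution D, and let f : {−1,1}^n → {−1,1} be the random linear threshold function f(x) = sign(w₀ + Σ_{i=1}^n w_i x_i). Then for every α > 0, with probability at least 1 − Pr[max_{0≤i≤n} |w_i| ≥ α] − e^{−(n+1)/(2M⁴)} over the choice of the weights, Inf(f) ≥ √((n+1)/2)/(2√2·α) − 1. -/
open Finset Real MeasureTheory ProbabilityTheory
open scoped Classical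

theorem sum_cons_bool {n : ℕ} (g : (Fin (n+1) → Bool) → ℝ) :
    ∑ x, g x = ∑ x : Fin n → Bool, (g (Fin.cons true x) + g (Fin.cons false x)) := by
  rw [← (Fin.consEquiv (fun _ : Fin (n+1) => Bool)).sum_comp, Fintype.sum_prod_type,
    Fintype.sum_bool, ← Finset.sum_add_distrib]
  rfl

theorem second_moment : ∀ (n : ℕ) (v : Fin n → ℝ) (a : ℝ),
    ∑ x : Fin n → Bool, (a + ∑ i, v i * pm (x i)) ^ 2 = 2 ^ n * (a ^ 2 + ∑ i, v i ^ 2) := by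
  intro n
  induction n with
  | zero => intro v a; simp
  | succ n ih =>
    intro v a
    rw [sum_cons_bool]
    simp only [Fin.sum_univ_succ, Fin.cons_zero, Fin.cons_succ, Finset.sum_add_distrib, ← add_assoc]
    rw [ih, ih]
    simp only [pm]
    simp
    ring

theorem fourth_moment : ∀ (n : ℕ) (v : Fin n → ℝ) (a : ℝ),
    ∑ x : Fin n → Bool, (a + ∑ i, v i * pm (x i)) ^ 4 ≤
      2 ^ n * (a ^ 4 + 6 * a ^ 2 * (∑ i, v i ^ 2) + 3 * (∑ i, v i ^ 2) ^ 2) := by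
  intro n
  induction n with
  | zero => intro v a; simp
  | succ n ih =>
    intro v a
    rw [sum_cons_bool]
    simp only [Fin.sum_univ_succ, Fin.cons_zero, Fin.cons_succ, Finset.sum_add_distrib, ← add_assoc]
    refine (add_le_add (ih _ _) (ih _ _)).trans ?_
    simp only [pm]
    simp
    rw [← mul_add, pow_succ (2:ℝ) n, mul_assoc ((2:ℝ) ^ n) 2]
    refine mul_le_mul_of_nonneg_left ?_ (by positivity)
    nlinarith [pow_nonneg (sq_nonneg (v 0)) 2, sq_nonneg (v 0)]

theorem khinchine (n : ℕ) (v : Fin n → ℝ) (a : ℝ) (s : ℝ) (hs : 0 < s)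
    (h : s ^ 2 = 3 * (a ^ 2 + ∑ i, v i ^ 2)) :
    2 ^ n * (s / 3) ≤ ∑ x : Fin n → Bool, |a + ∑ i, v i * pm (x i)| := by
  have h4 := fourth_moment n v a
  have h2 := second_moment n v a
  set Q := ∑ i, v i ^ 2
  have pt : ∀ t : ℝ, 3 / (2 * s) * t ^ 2 - 1 / (2 * s ^ 3) * t ^ 4 ≤ |t| := by
    intro t
    have e2 : t ^ 2 = |t| ^ 2 := (sq_abs t).symm
    have e4 : t ^ 4 = |t| ^ 4 := by rw [show t ^ 4 = (t ^ 2) ^ 2 by ring, e2]; ring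
    rw [e2, e4]
    have h0 := abs_nonneg t
    generalize |t| = u at h0 ⊢
    have : u - (3 / (2 * s) * u ^ 2 - 1 / (2 * s ^ 3) * u ^ 4)
        = u * (u - s) ^ 2 * (u + 2 * s) / (2 * s ^ 3) := by field_simp; ring
    have : 0 ≤ u * (u - s) ^ 2 * (u + 2 * s) / (2 * s ^ 3) := by positivity
    linarith
  have hsum := Finset.sum_le_sum (fun (x : Fin n → Bool) (_ : x ∈ Finset.univ) =>
    pt (a + ∑ i, v i * pm (x i)))
  refine le_trans ?_ hsum
  rw [Finset.sum_sub_distrib, ← Finset.mul_sum, ← Finset.mul_sum, h2]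
  have hb : ∑ x : Fin n → Bool, (a + ∑ i, v i * pm (x i)) ^ 4 ≤ 2 ^ n * (s ^ 4 / 3) := by
    refine h4.trans (mul_le_mul_of_nonneg_left ?_ (by positivity))
    rw [show s ^ 4 = (s ^ 2) ^ 2 by ring, h]
    nlinarith [pow_nonneg (sq_nonneg a) 2]
  have hb' := mul_le_mul_of_nonneg_left hb (show 0 ≤ 1 / (2 * s ^ 3) by positivity)
  have : a ^ 2 + Q = s ^ 2 / 3 := by linarith
  rw [this]
  have e : (2:ℝ) ^ n * (s / 3) = 3 / (2 * s) * (2 ^ n * (s ^ 2 / 3))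
    - 1 / (2 * s ^ 3) * (2 ^ n * (s ^ 4 / 3)) := by field_simp; ring
  linarith

theorem flipAt_flipAt {n : ℕ} (i : Fin n) (x : Fin n → Bool) : flipAt i (flipAt i x) = x := by
  simp [flipAt]

theorem pm_flip {n : ℕ} (i : Fin n) (x : Fin n → Bool) : pm (flipAt i x i) = - pm (x i) := by
  cases h : x i <;> simp [flipAt, pm, h]

theorem sgn_cases (z : ℝ) : sgn z = 1 ∨ sgn z = -1 := by
  unfold sgn; split_ifs <;> simp

theorem coeff_le {n : ℕ} (f : (Fin n → Bool) → ℝ) (hf : ∀ x, f x = 1 ∨ f x = -1) (i : Fin n) :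
    |∑ x, f x * pm (x i)| ≤ 2 ^ n * infl f i := by
  have e1 : ∑ x, f x * pm (x i) = ∑ x, f (flipAt i x) * pm (flipAt i x i) :=
    (Equiv.sum_comp (Function.Involutive.toPerm (flipAt i) (flipAt_flipAt i))
      (fun x => f x * pm (x i))).symm
  have e2 : ∑ x, f x * pm (x i) = ∑ x, (f x - f (flipAt i x)) / 2 * pm (x i) := by
    have : ∑ x, f x * pm (x i) = (∑ x, f x * pm (x i) + ∑ x, f (flipAt i x) * pm (flipAt i x i)) / 2 := by
      rw [← e1]; ring
    rw [this, ← Finset.sum_add_distrib, Finset.sum_div]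
    refine Finset.sum_congr rfl fun x _ => ?_
    rw [pm_flip]; ring
  have e3 : 2 ^ n * infl f i = ∑ x, if f x ≠ f (flipAt i x) then (1:ℝ) else 0 := by
    unfold infl unifPr
    rw [mul_div_cancel₀ _ (by positivity), Finset.sum_boole]
    congr!
  rw [e2, e3]
  refine (Finset.abs_sum_le_sum_abs _ _).trans (Finset.sum_le_sum fun x _ => ?_)
  have hp : |pm (x i)| = 1 := by unfold pm; split_ifs <;> simp
  rw [abs_mul, hp, mul_one]
  rcases hf x with h | h <;> rcases hf (flipAt i x) with h' | h' <;> rw [h, h'] <;> norm_num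

theorem infl_bound {n : ℕ} (w : Fin (n + 1) → ℝ) (α : ℝ) (h : ∀ i, |w i| ≤ α) :
    ∑ x : Fin n → Bool, |w 0 + ∑ i : Fin n, w i.succ * pm (x i)| ≤
      2 ^ n * (α * (1 + totalInfl (ltf n w))) := by
  have hf : ∀ x, ltf n w x = 1 ∨ ltf n w x = -1 := fun x => sgn_cases _
  have habs : ∀ x : Fin n → Bool, |w 0 + ∑ i : Fin n, w i.succ * pm (x i)|
      = ltf n w x * w 0 + ∑ i : Fin n, w i.succ * (ltf n w x * pm (x i)) := by
    intro x
    have : |w 0 + ∑ i : Fin n, w i.succ * pm (x i)|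
      = ltf n w x * (w 0 + ∑ i : Fin n, w i.succ * pm (x i)) := by
      unfold ltf sgn
      split_ifs with hz
      · rw [abs_of_pos hz, one_mul]
      · rw [abs_of_nonpos (not_lt.mp hz)]; ring
    rw [this, mul_add, Finset.mul_sum]
    congr 1
    exact Finset.sum_congr rfl fun i _ => by ring
  simp_rw [habs]
  rw [Finset.sum_add_distrib, Finset.sum_comm]
  have hα : 0 ≤ α := (abs_nonneg _).trans (h 0)
  have h1 : ∑ x, ltf n w x * w 0 ≤ 2 ^ n * α := by
    have : ∑ x : Fin n → Bool, ltf n w x * w 0 ≤ ∑ x : Fin n → Bool, α := by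
      refine Finset.sum_le_sum fun x _ => (le_abs_self _).trans ?_
      rw [abs_mul]
      rcases hf x with h' | h' <;> rw [h'] <;> simpa using h 0
    simpa using this
  have h2 : ∑ i : Fin n, ∑ x, w i.succ * (ltf n w x * pm (x i)) ≤
      ∑ i : Fin n, α * (2 ^ n * infl (ltf n w) i) := by
    refine Finset.sum_le_sum fun i _ => ?_
    rw [← Finset.mul_sum]
    refine (le_abs_self _).trans ?_
    rw [abs_mul]
    exact mul_le_mul (h _) (coeff_le _ hf i) (abs_nonneg _) hα
  rw [← Finset.mul_sum, ← Finset.mul_sum] at h2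
  unfold totalInfl
  linarith

theorem det_bound {n : ℕ} (w : Fin (n + 1) → ℝ) (α : ℝ) (hα : 0 < α) (h : ∀ i, |w i| ≤ α)
    (hQ : ((n:ℝ) + 1) / 2 ≤ ∑ i, w i ^ 2) :
    Real.sqrt (((n : ℝ) + 1) / 2) / (2 * Real.sqrt 2 * α) - 1 ≤ totalInfl (ltf n w) := by
  have hb := infl_bound w α h
  have hpos : 0 < ((n:ℝ) + 1) / 2 := by positivity
  set R := ∑ i, w i ^ 2 with hR
  have hR0 : 0 < R := hpos.trans_le hQ
  have hk := khinchine n (fun i => w i.succ) (w 0) (Real.sqrt (3 * R)) (by positivity) (by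
    rw [Real.sq_sqrt (by positivity), hR, Fin.sum_univ_succ])
  have := le_of_mul_le_mul_left (hk.trans hb) (by positivity)
  have key : Real.sqrt (((n : ℝ) + 1) / 2) / (2 * Real.sqrt 2) ≤ Real.sqrt (3 * R) / 3 := by
    rw [div_le_div_iff₀ (by positivity) (by positivity)]
    have e1 : Real.sqrt (((n : ℝ) + 1) / 2) ≤ Real.sqrt R := Real.sqrt_le_sqrt hQ
    have e2 : Real.sqrt (3 * R) = Real.sqrt 3 * Real.sqrt R := Real.sqrt_mul (by norm_num) _
    have e3 : 3 ≤ Real.sqrt 3 * (2 * Real.sqrt 2) := by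
      have a1 : (1.7:ℝ) ≤ Real.sqrt 3 := Real.le_sqrt_of_sq_le (by norm_num)
      have a2 : (1.4:ℝ) ≤ Real.sqrt 2 := Real.le_sqrt_of_sq_le (by norm_num)
      nlinarith
    rw [e2]
    nlinarith [Real.sqrt_nonneg R]
  have : Real.sqrt (((n : ℝ) + 1) / 2) / (2 * Real.sqrt 2 * α) ≤ 1 + totalInfl (ltf n w) := by
    rw [← div_div, div_le_iff₀ hα]
    linarith
  linarith

theorem conc (M : ℝ) (hM : 1 ≤ M)
    (D : Measure ℝ) [IsProbabilityMeasure D]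
    (hsupp : ∀ᵐ v ∂D, v ∈ Set.Icc (-M) M)
    (hvar : ∫ v, v ^ 2 ∂D = 1) (n : ℕ) :
    (Measure.pi fun _ : Fin (n + 1) => D).real
      {w : Fin (n + 1) → ℝ | ∑ i, w i ^ 2 ≤ ((n:ℝ) + 1) / 2} ≤
      Real.exp (-((n : ℝ) + 1) / (2 * M ^ 4)) := by
  have hsub : HasSubgaussianMGF (fun v : ℝ => 1 - v ^ 2) ((‖(1:ℝ) - (1 - M ^ 2)‖₊ / 2) ^ 2) D := by
    have := hasSubgaussianMGF_of_mem_Icc (μ := D) (X := fun v : ℝ => 1 - v ^ 2)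
      (a := 1 - M ^ 2) (b := 1) (by fun_prop) (by
        filter_upwards [hsupp] with v hv
        constructor <;> nlinarith [hv.1, hv.2, sq_nonneg v])
    have hi : Integrable (fun v : ℝ => v ^ 2) D := by
      by_contra hc
      rw [integral_undef hc] at hvar
      norm_num at hvar
    rw [integral_sub (integrable_const _) hi, hvar] at this
    simpa using this
  have hind : iIndepFun (fun (i : Fin (n+1)) (w : Fin (n + 1) → ℝ) => 1 - (w i) ^ 2)
      (Measure.pi fun _ : Fin (n + 1) => D) :=
    iIndepFun_pi (X := fun _ v => 1 - v ^ 2) (fun i => by fun_prop)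
  have hs : ∀ i ∈ (Finset.univ : Finset (Fin (n+1))),
      HasSubgaussianMGF (fun (w : Fin (n + 1) → ℝ) => 1 - (w i) ^ 2)
        ((‖(1:ℝ) - (1 - M ^ 2)‖₊ / 2) ^ 2) (Measure.pi fun _ : Fin (n + 1) => D) := by
    intro i _
    have hm := (measurePreserving_eval (fun _ : Fin (n + 1) => D) i)
    refine HasSubgaussianMGF.of_map (Y := fun w : Fin (n+1) → ℝ => w i) (X := fun v : ℝ => 1 - v ^ 2) (measurable_pi_apply i).aemeasurable ?_
    have : Measure.map (fun w : Fin (n+1) → ℝ => w i) (Measure.pi fun _ : Fin (n + 1) => D) = D :=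
      hm.map_eq
    rw [this]; exact hsub
  have H := HasSubgaussianMGF.measure_sum_ge_le_of_iIndepFun hind hs
    (ε := ((n:ℝ) + 1) / 2) (by positivity)
  have hset : {w : Fin (n + 1) → ℝ | ∑ i, w i ^ 2 ≤ ((n:ℝ) + 1) / 2} =
      {w : Fin (n + 1) → ℝ | ((n:ℝ) + 1) / 2 ≤ ∑ i, (1 - w i ^ 2)} := by
    ext w
    simp only [Set.mem_setOf_eq, Finset.sum_sub_distrib, Finset.sum_const, Finset.card_univ,
      Fintype.card_fin, nsmul_eq_mul]
    push_cast
    constructor <;> intro h <;> linarith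
  rw [hset]
  refine H.trans (le_of_eq ?_)
  congr 1
  have hM0 : M ≠ 0 := by linarith
  simp
  have : |M| ^ 4 = M ^ 4 := by rw [show |M| ^ 4 = (|M| ^ 2) ^ 2 by ring, sq_abs]; ring
  field_simp
  try rw [this]
  try ring

/-- influence lower bound for a random LTF with i.i.d. bounded
weights of unit second moment. -/
theorem random_bounded_ltf_influence (M : ℝ) (hM : 1 ≤ M)
    (D : Measure ℝ) [IsProbabilityMeasure D]
    (hsupp : ∀ᵐ v ∂D, v ∈ Set.Icc (-M) M)
    (hvar : ∫ v, v ^ 2 ∂D = 1)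
    (n : ℕ) (α : ℝ) (hα : 0 < α) :
    (Measure.pi fun _ : Fin (n + 1) => D)
        {w : Fin (n + 1) → ℝ |
          Real.sqrt (((n : ℝ) + 1) / 2) / (2 * Real.sqrt 2 * α) - 1 ≤ totalInfl (ltf n w)} ≥
      ENNReal.ofReal
        (1 - ((Measure.pi fun _ : Fin (n + 1) => D)
                {w : Fin (n + 1) → ℝ | ∃ i, α ≤ |w i|}).toReal
           - Real.exp (-((n : ℝ) + 1) / (2 * M ^ 4))) := by
  set μ := (Measure.pi fun _ : Fin (n + 1) => D) with hμ
  set A : Set (Fin (n + 1) → ℝ) := {w | ∃ i, α ≤ |w i|} with hA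
  have hc := conc M hM D hsupp hvar n
  rw [← hμ] at hc
  set B : Set (Fin (n + 1) → ℝ) := {w | ∑ i, w i ^ 2 ≤ ((n:ℝ) + 1) / 2} with hB
  have mA : MeasurableSet A := by
    have : A = ⋃ i, {w | α ≤ |w i|} := by ext; simp [hA]
    rw [this]
    exact MeasurableSet.iUnion fun i => measurableSet_le (by fun_prop) (by fun_prop)
  have mB : MeasurableSet B := measurableSet_le (by fun_prop) (by fun_prop)
  have hsubset : (A ∪ B)ᶜ ⊆ {w : Fin (n + 1) → ℝ |
          Real.sqrt (((n : ℝ) + 1) / 2) / (2 * Real.sqrt 2 * α) - 1 ≤ totalInfl (ltf n w)} := by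
    intro w hw
    simp only [hA, hB, Set.mem_compl_iff, Set.mem_union, Set.mem_setOf_eq, not_or, not_exists,
      not_le] at hw
    exact det_bound w α hα (fun i => (hw.1 i).le) hw.2.le
  refine le_trans ?_ (measure_mono hsubset)
  rw [← ofReal_measureReal (μ := μ) (s := (A ∪ B)ᶜ) (measure_ne_top μ _)]
  refine ENNReal.ofReal_le_ofReal ?_
  rw [probReal_compl_eq_one_sub (mA.union mB)]
  have := measureReal_union_le (μ := μ) A B
  have e : (μ A).toReal = μ.real A := rfl
  rw [e]
  linarith
end
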